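/- Let V : ℝ → ℝ be C^∞ with V(0)=0, V'(t)=0 if and only if t=0, V''(0)=2, and V(t) → ∞ as t → ±∞. Then for every E > 0 there exists a unique t₀(E) with t₋(E) < t₀(E) < t₊(E) such that ∫_{t₋(E)}^{t₀(E)} √(E − V(t)) dt = ∫_{t₀(E)}^{t₊(E)} √(E − V(t)) dt, and the function E ↦ t₀(E) is C^∞-smooth on (0,∞). -/

import Mathlib

open Filter Set intervalIntegral

/-- Differentiation under the integral sign for a jointly `C^1` integrand. -/
theorem hasFDerivAt_intervalIntegral_of_contDiff
    {E : Type*} [NormedAddCommGroup E] [NormedSpace ℝ E] [ProperSpace E]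
    {F : Type*} [NormedAddCommGroup F] [NormedSpace ℝ F]
    {g : E × ℝ → F} (hg : ContDiff ℝ 1 g) (a b : ℝ) (p : E) :
    HasFDerivAt (fun q => ∫ s in a..b, g (q, s))
      (∫ s in a..b, (fderiv ℝ g (p, s)).comp (.inl ℝ E ℝ)) p := by
  have hd : Continuous fun q : E × ℝ => (fderiv ℝ g q).comp (.inl ℝ E ℝ) :=
    (hg.continuous_fderiv one_ne_zero).clm_comp continuous_const
  obtain ⟨C, hC⟩ := ((isCompact_closedBall p 1).prod (isCompact_uIcc (a := a) (b := b))
    ).exists_bound_of_continuousOn hd.continuousOn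
  refine hasFDerivAt_integral_of_dominated_of_fderiv_le
    (s := Metric.closedBall p 1) (bound := fun _ => C)
    (F' := fun q s => (fderiv ℝ g (q, s)).comp (.inl ℝ E ℝ))
    (Metric.closedBall_mem_nhds p one_pos) ?_ ?_ ?_ ?_ ?_ ?_
  · exact .of_forall fun q => (hg.continuous.comp (by fun_prop)).aestronglyMeasurable
  · exact (hg.continuous.comp (by fun_prop)).intervalIntegrable _ _
  · exact (hd.comp (by fun_prop : Continuous fun s : ℝ => (p, s))).aestronglyMeasurable
  · exact .of_forall fun t ht q hq => hC (q, t) ⟨hq, uIoc_subset_uIcc ht⟩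
  · exact intervalIntegrable_const
  · exact .of_forall fun t _ q _ =>
      ((hg.differentiable one_ne_zero) (q, t)).hasFDerivAt.comp q (hasFDerivAt_prodMk_left q t)

/-- An integral over a fixed interval depends smoothly on the parameter when the integrand is
jointly smooth. -/
theorem contDiff_intervalIntegral_of_contDiff
    {E : Type} [NormedAddCommGroup E] [NormedSpace ℝ E] [ProperSpace E]
    {F : Type} [NormedAddCommGroup F] [NormedSpace ℝ F]
    {g : E × ℝ → F} (hg : ContDiff ℝ (⊤ : ℕ∞) g) (a b : ℝ) :
    ContDiff ℝ (⊤ : ℕ∞) (fun p => ∫ s in a..b, g (p, s)) := by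
  refine contDiff_infty.2 fun n => ?_
  induction n generalizing F with
  | zero =>
    exact contDiff_zero.2 (continuous_parametric_intervalIntegral_of_continuous'
      (f := fun p s => g (p, s)) hg.continuous a b)
  | succ n ih =>
    have h := hasFDerivAt_intervalIntegral_of_contDiff (hg.of_le (by simp)) a b
    push_cast
    refine contDiff_succ_iff_fderiv.2 ⟨fun p => (h p).differentiableAt, by simp, ?_⟩
    rw [show fderiv ℝ (fun p => ∫ s in a..b, g (p, s)) = _ from funext fun p => (h p).fderiv]
    exact ih ((hg.fderiv_right (m := (⊤ : ℕ∞)) (by simp)).clm_comp contDiff_const)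

/-- The primitive of a jointly smooth function is jointly smooth in the parameter and the upper
endpoint. -/
theorem contDiff_primitive_of_contDiff {h : ℝ × ℝ → ℝ} (hh : ContDiff ℝ (⊤ : ℕ∞) h) (a : ℝ) :
    ContDiff ℝ (⊤ : ℕ∞) (fun p : ℝ × ℝ => ∫ x in a..p.2, h (p.1, x)) := by
  have key : (fun p : ℝ × ℝ => ∫ x in a..p.2, h (p.1, x)) =
      fun p => (p.2 - a) * ∫ s in (0 : ℝ)..1, h (p.1, (p.2 - a) * s + a) := by
    ext p
    rw [mul_integral_comp_mul_add (f := fun x => h (p.1, x))]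
    simp
  rw [key]
  refine (contDiff_snd.sub contDiff_const).mul (contDiff_intervalIntegral_of_contDiff
    (g := fun q : (ℝ × ℝ) × ℝ => h (q.1.1, (q.1.2 - a) * q.2 + a)) (hh.comp ?_) 0 1)
  fun_prop

/-- The Hadamard factorization of a smooth function vanishing at the origin. -/
theorem exists_contDiff_eq_mul {f : ℝ → ℝ} (hf : ContDiff ℝ (⊤ : ℕ∞) f) (h0 : f 0 = 0) :
    ∃ g : ℝ → ℝ, ContDiff ℝ (⊤ : ℕ∞) g ∧ (∀ t, f t = t * g t) ∧ g 0 = deriv f 0 := by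
  have hf' : ContDiff ℝ (⊤ : ℕ∞) (deriv f) := (contDiff_infty_iff_deriv.1 hf).2
  refine ⟨fun t => ∫ s in (0 : ℝ)..1, deriv f (t * s),
    contDiff_intervalIntegral_of_contDiff (g := fun q : ℝ × ℝ => deriv f (q.1 * q.2))
      (hf'.comp (by fun_prop)) 0 1, fun t => ?_, by simp⟩
  rw [mul_integral_comp_mul_left, integral_deriv_eq_sub
    (fun x _ => hf.differentiable (by simp) x) (hf'.continuous.intervalIntegrable _ _)]
  simp [h0]

/-- The point that halves the integral of a positive function depends smoothly on parameters. -/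
theorem exists_contDiff_halving_point {h : ℝ × ℝ → ℝ} (hh : ContDiff ℝ (⊤ : ℕ∞) h) {a b : ℝ}
    (hab : a < b) (hpos : ∀ r, ∀ x ∈ Ioo a b, 0 < h (r, x)) :
    ∃ θ : ℝ → ℝ, ContDiff ℝ (⊤ : ℕ∞) θ ∧ ∀ r, θ r ∈ Ioo a b ∧ ∀ x ∈ Ioo a b,
      (∫ y in a..x, h (r, y)) = (∫ y in x..b, h (r, y)) ↔ x = θ r := by
  let G : ℝ × ℝ → ℝ := fun p => (∫ y in a..p.2, h (p.1, y)) + ∫ y in b..p.2, h (p.1, y)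
  have hG : ContDiff ℝ (⊤ : ℕ∞) G :=
    (contDiff_primitive_of_contDiff hh a).add (contDiff_primitive_of_contDiff hh b)
  have hcont (r : ℝ) : Continuous fun y => h (r, y) := hh.continuous.comp (by fun_prop)
  have hiff (r x : ℝ) : (∫ y in a..x, h (r, y)) = (∫ y in x..b, h (r, y)) ↔ G (r, x) = 0 := by
    simp only [G]
    rw [integral_symm x b]
    constructor <;> intro H <;> linarith
  have hGd (r x : ℝ) : HasDerivAt (fun x => G (r, x)) (2 * h (r, x)) x := by
    rw [two_mul]
    exact ((hcont r).integral_hasStrictDerivAt a x).hasDerivAt.add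
      ((hcont r).integral_hasStrictDerivAt b x).hasDerivAt
  have hGc (r : ℝ) : Continuous fun x => G (r, x) := hG.continuous.comp (by fun_prop)
  have hmono (r : ℝ) : StrictMonoOn (fun x => G (r, x)) (Icc a b) := by
    refine strictMonoOn_of_deriv_pos (convex_Icc a b) (hGc r).continuousOn fun x hx => ?_
    rw [interior_Icc] at hx
    rw [(hGd r x).deriv]
    exact mul_pos two_pos (hpos r x hx)
  have hIpos (r : ℝ) : 0 < ∫ y in a..b, h (r, y) :=
    intervalIntegral_pos_of_pos_on ((hcont r).intervalIntegrable _ _) (hpos r) hab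
  have hex (r : ℝ) : ∃ x ∈ Ioo a b, G (r, x) = 0 :=
    intermediate_value_Ioo hab.le (hGc r).continuousOn
      ⟨by simpa [G, integral_symm a b] using hIpos r, by simpa [G] using hIpos r⟩
  choose θ hθ hGθ using hex
  have huniq (r x : ℝ) (hx : x ∈ Ioo a b) : G (r, x) = 0 ↔ x = θ r :=
    ⟨fun H => (hmono r).injOn (Ioo_subset_Icc_self hx) (Ioo_subset_Icc_self (hθ r))
      (H.trans (hGθ r).symm), fun H => H ▸ hGθ r⟩
  refine ⟨θ, contDiff_iff_contDiffAt.2 fun r => ?_, fun r => ⟨hθ r, fun x hx => ?_⟩⟩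
  · have hGr : ContDiffAt ℝ (⊤ : ℕ∞) G (r, θ r) := hG.contDiffAt
    have hinv : (fderiv ℝ G (r, θ r) ∘L .inr ℝ ℝ ℝ).IsInvertible := by
      have h1 : HasFDerivAt (fun x => G (r, x)) (fderiv ℝ G (r, θ r) ∘L .inr ℝ ℝ ℝ) (θ r) :=
        ((hG.differentiable (by simp)) (r, θ r)).hasFDerivAt.comp (θ r)
          (hasFDerivAt_prodMk_right r (θ r))
      have hne : 2 * h (r, θ r) ≠ 0 := (mul_pos two_pos (hpos r _ (hθ r))).ne'
      refine ⟨ContinuousLinearEquiv.unitsEquivAut ℝ (Units.mk0 _ hne), ?_⟩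
      rw [h1.unique (hGd r (θ r)).hasFDerivAt]
      ext
      simp
    have hψ := hGr.contDiffAt_implicitFunction (by simp) hinv
    have hψ0 := hGr.implicitFunction_apply_self (by simp) hinv
    refine hψ.congr_of_eventuallyEq ?_
    filter_upwards [hGr.eventually_apply_implicitFunction (by simp) hinv,
      hψ.continuousAt.eventually_mem
        (by rw [hψ0]; exact isOpen_Ioo.mem_nhds (hθ r))] with q hq hq'
    exact ((huniq q _ hq').1 (hq.trans (hGθ r))).symm
  · rw [hiff, huniq r x hx]

/-- A single well potential vanishing at its critical point is positive elsewhere. -/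
theorem pos_of_deriv_eq_zero_iff {V : ℝ → ℝ} (hV : Continuous V) (hV0 : V 0 = 0)
    (hVcrit : ∀ t, deriv V t = 0 ↔ t = 0) (hVtop : Tendsto V atTop atTop)
    (hVbot : Tendsto V atBot atTop) {t : ℝ} (ht : t ≠ 0) : 0 < V t := by
  by_contra! hle
  rcases ht.lt_or_gt with h | h
  · obtain ⟨M, hMt, hM⟩ := (((eventually_le_atBot t).and (hVbot.eventually_ge_atTop 0))).exists
    obtain ⟨c, hc, hVc⟩ := intermediate_value_Icc' hMt hV.continuousOn ⟨hle, hM⟩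
    obtain ⟨d, hd, hVd⟩ := exists_deriv_eq_zero (hc.2.trans_lt h) hV.continuousOn (hVc.trans hV0.symm)
    exact hd.2.ne ((hVcrit d).1 hVd)
  · obtain ⟨M, hMt, hM⟩ := (((eventually_ge_atTop t).and (hVtop.eventually_ge_atTop 0))).exists
    obtain ⟨c, hc, hVc⟩ := intermediate_value_Icc hMt hV.continuousOn ⟨hle, hM⟩
    obtain ⟨d, hd, hVd⟩ := exists_deriv_eq_zero (h.trans_le hc.1) hV.continuousOn (hV0.trans hVc.symm)
    exact hd.1.ne' ((hVcrit d).1 hVd)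

/-- A single well potential is the square of a global smooth increasing coordinate. -/
theorem exists_homeomorph_sq_eq {V : ℝ → ℝ} (hV : ContDiff ℝ (⊤ : ℕ∞) V) (hV0 : V 0 = 0)
    (hVcrit : ∀ t, deriv V t = 0 ↔ t = 0) (hV'' : 0 < deriv (deriv V) 0)
    (hVtop : Tendsto V atTop atTop) (hVbot : Tendsto V atBot atTop) :
    ∃ u : ℝ ≃ₜ ℝ, StrictMono u ∧ u 0 = 0 ∧ (∀ t, V t = u t ^ 2) ∧
      ContDiff ℝ (⊤ : ℕ∞) u.symm ∧ ∀ x, 0 < deriv u.symm x := by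
  obtain ⟨g, hg, hVg, hg0⟩ := exists_contDiff_eq_mul hV hV0
  obtain ⟨W, hW, hgW, -⟩ := exists_contDiff_eq_mul hg (hg0.trans ((hVcrit 0).2 rfl))
  have hVW (t : ℝ) : V t = t ^ 2 * W t := by rw [hVg, hgW]; ring
  have hWd (t : ℝ) : HasDerivAt W (deriv W t) t := (hW.differentiable (by simp) t).hasDerivAt
  have hV' : deriv V = fun t => t * (2 * W t + t * deriv W t) := by
    ext t
    rw [funext hVW]
    refine (((hasDerivAt_pow 2 t).mul (hWd t)).congr_deriv ?_).deriv
    simp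
    ring
  have hW0 : 0 < W 0 := by
    have hd : DifferentiableAt ℝ (fun t => 2 * W t + t * deriv W t) 0 :=
      ((hWd 0).differentiableAt.const_mul 2).add (differentiableAt_id.mul
        (((contDiff_infty_iff_deriv.1 hW).2).differentiable (by simp) 0))
    have := ((hasDerivAt_id (0 : ℝ)).mul hd.hasDerivAt).deriv
    rw [hV'] at hV''
    rw [show (fun t => t * (2 * W t + t * deriv W t)) =
      id * fun t => 2 * W t + t * deriv W t from rfl, this] at hV''
    simpa using hV''
  have hWpos (t : ℝ) : 0 < W t := by
    rcases eq_or_ne t 0 with rfl | ht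
    · exact hW0
    · have := pos_of_deriv_eq_zero_iff hV.continuous hV0 hVcrit hVtop hVbot ht
      rw [hVW] at this
      exact pos_of_mul_pos_right this (sq_nonneg t)
  let v : ℝ → ℝ := fun t => t * √(W t)
  have hv : ContDiff ℝ (⊤ : ℕ∞) v := contDiff_id.mul (hW.sqrt fun t => (hWpos t).ne')
  have hVv (t : ℝ) : V t = v t ^ 2 := by rw [hVW, mul_pow, Real.sq_sqrt (hWpos t).le]
  have hvd (t : ℝ) : HasDerivAt v (deriv v t) t := (hv.differentiable (by simp) t).hasDerivAt
  have hv0' : 0 < deriv v 0 := by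
    have := ((hasDerivAt_id (0 : ℝ)).mul ((hWd 0).sqrt hW0.ne')).deriv
    rw [show v = id * fun t => √(W t) from rfl, this]
    simpa using hW0
  have hvne (t : ℝ) : deriv v t ≠ 0 := by
    intro h
    have h1 : deriv V t = 0 := by
      rw [funext hVv, ((hvd t).fun_pow 2).deriv, h, mul_zero]
    rw [(hVcrit t).1 h1] at h
    exact hv0'.ne' h
  have hvpos (t : ℝ) : 0 < deriv v t :=
    (hasDerivWithinAt_forall_lt_or_forall_gt_of_forall_ne convex_univ
      (fun x _ => (hvd x).hasDerivWithinAt) (fun x _ => hvne x)).elim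
      (fun h => absurd (h 0 trivial) hv0'.not_gt) fun h => h t trivial
  have hvmono : StrictMono v := strictMono_of_deriv_pos hvpos
  have hsqrt : Tendsto (fun t => √t) atTop atTop := Real.tendsto_sqrt_atTop
  have hvtop : Tendsto v atTop atTop := by
    refine (hsqrt.comp hVtop).congr' ?_
    filter_upwards [eventually_ge_atTop 0] with t ht
    rw [Function.comp, hVv, Real.sqrt_sq (mul_nonneg ht (Real.sqrt_nonneg _))]
  have hvbot : Tendsto v atBot atBot := by
    refine (tendsto_neg_atTop_atBot.comp (hsqrt.comp hVbot)).congr' ?_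
    filter_upwards [eventually_le_atBot 0] with t ht
    simp only [Function.comp]
    rw [hVv, Real.sqrt_sq_eq_abs,
      abs_of_nonpos (mul_nonpos_of_nonpos_of_nonneg ht (Real.sqrt_nonneg _)), neg_neg]
  let u : ℝ ≃ₜ ℝ :=
    (hvmono.orderIsoOfSurjective v (hv.continuous.surjective hvtop hvbot)).toHomeomorph
  have huv : ⇑u = v := rfl
  have hud (t : ℝ) : HasDerivAt u (deriv v t) t := hvd t
  refine ⟨u, hvmono, by simp [huv, v], hVv, u.contDiff_symm_deriv hvne hud hv, fun x => ?_⟩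
  have := (hud (u.symm x)).of_local_left_inverse u.symm.continuous.continuousAt (hvne _)
    (.of_forall u.apply_symm_apply)
  rw [this.deriv]
  exact inv_pos.2 (hvpos _)

/-- The action integral in the angular coordinate `x` given by `u t = r * sin x`. -/
theorem integral_sqrt_sub_eq {V φ : ℝ → ℝ} (hφ : ContDiff ℝ 1 φ) (hVφ : ∀ x, V (φ x) = x ^ 2)
    (hV : Continuous V) {r : ℝ} (hr : 0 ≤ r) {a b : ℝ} (ha : a ∈ Icc (-(Real.pi / 2)) (Real.pi / 2))
    (hb : b ∈ Icc (-(Real.pi / 2)) (Real.pi / 2)) :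
    (∫ t in φ (r * Real.sin a)..φ (r * Real.sin b), √(r ^ 2 - V t)) =
      r ^ 2 * ∫ x in a..b, Real.cos x ^ 2 * deriv φ (r * Real.sin x) := by
  have hφ' : Continuous (deriv φ) := hφ.continuous_deriv le_rfl
  rw [← integral_comp_mul_deriv (f := fun x => φ (r * Real.sin x))
    (f' := fun x => deriv φ (r * Real.sin x) * (r * Real.cos x)) (fun x _ => ?_) (by fun_prop)
    (by fun_prop : Continuous fun t => √(r ^ 2 - V t)), ← integral_const_mul]
  · refine integral_congr fun x hx => ?_
    have hcos : 0 ≤ Real.cos x := Real.cos_nonneg_of_mem_Icc (uIcc_subset_Icc ha hb hx)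
    have hsq : r ^ 2 - (r * Real.sin x) ^ 2 = (r * Real.cos x) ^ 2 := by
      rw [mul_pow, mul_pow, Real.cos_sq']
      ring
    simp only [Function.comp, hVφ, hsq, Real.sqrt_sq (mul_nonneg hr hcos)]
    ring
  · exact ((hφ.differentiable one_ne_zero _).hasDerivAt).comp x
      ((Real.hasDerivAt_sin x).const_mul r)

/-- With `V` a single well potential and turning points
`t₋(E) < 0 < t₊(E)`, for every `E > 0` there is a unique `t₀(E) ∈ (t₋(E), t₊(E))`
splitting the action integral in two equal halves:
`∫_{t₋(E)}^{t₀(E)} √(E - V t) dt = ∫_{t₀(E)}^{t₊(E)} √(E - V t) dt`,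
and `E ↦ t₀(E)` is `C^∞` on `(0, ∞)`. -/
theorem stmt4 (V : ℝ → ℝ)
    (hV : ContDiff ℝ (⊤ : ℕ∞) V)
    (hV0 : V 0 = 0)
    (hVcrit : ∀ t : ℝ, deriv V t = 0 ↔ t = 0)
    (hV'' : deriv (deriv V) 0 = 2)
    (hVtop : Tendsto V atTop atTop)
    (hVbot : Tendsto V atBot atTop)
    (tm tp : ℝ → ℝ)
    (htm : ∀ E : ℝ, 0 < E → tm E < 0 ∧ V (tm E) = E)
    (htp : ∀ E : ℝ, 0 < E → 0 < tp E ∧ V (tp E) = E) :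
    ∃ t0 : ℝ → ℝ,
      ContDiffOn ℝ (⊤ : ℕ∞) t0 (Ioi 0) ∧
      ∀ E : ℝ, 0 < E →
        (tm E < t0 E ∧ t0 E < tp E ∧
          (∫ t in tm E..t0 E, Real.sqrt (E - V t)) =
            ∫ t in t0 E..tp E, Real.sqrt (E - V t)) ∧
        (∀ s : ℝ, tm E < s → s < tp E →
          (∫ t in tm E..s, Real.sqrt (E - V t)) =
            (∫ t in s..tp E, Real.sqrt (E - V t)) → s = t0 E) := by
  obtain ⟨u, hu, hu0, hVu, hφ, hφ'⟩ :=
    exists_homeomorph_sq_eq hV hV0 hVcrit (hV'' ▸ two_pos) hVtop hVbot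
  have hVφ (x : ℝ) : V (u.symm x) = x ^ 2 := by rw [hVu, u.apply_symm_apply]
  have hφmono : StrictMono u.symm := fun x y hxy => by
    rwa [← hu.lt_iff_lt, u.apply_symm_apply, u.apply_symm_apply]
  have hπ : -(Real.pi / 2) < Real.pi / 2 := by linarith [Real.pi_pos]
  obtain ⟨θ, hθ, hθprop⟩ := exists_contDiff_halving_point
    (h := fun p => Real.cos p.2 ^ 2 * deriv u.symm (p.1 * Real.sin p.2))
    (((Real.contDiff_cos.comp contDiff_snd).pow 2).mul
      ((contDiff_infty_iff_deriv.1 hφ).2.comp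
        (contDiff_fst.mul (Real.contDiff_sin.comp contDiff_snd)))) hπ
    fun r x hx => mul_pos (pow_pos (Real.cos_pos_of_mem_Ioo hx) 2) (hφ' _)
  let t0 : ℝ → ℝ := fun E => u.symm (√E * Real.sin (θ √E))
  have hcomp (E : ℝ) (hE : 0 < E) : tm E = u.symm (√E * Real.sin (-(Real.pi / 2))) ∧
      tp E = u.symm (√E * Real.sin (Real.pi / 2)) := by
    obtain ⟨hm, hmE⟩ := htm E hE
    obtain ⟨hp, hpE⟩ := htp E hE
    rw [hVu] at hmE hpE
    rw [Real.sin_neg, Real.sin_pi_div_two, u.eq_symm_apply, u.eq_symm_apply]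
    constructor
    · have := congrArg Real.sqrt hmE
      rw [Real.sqrt_sq_eq_abs, abs_of_neg (hu0 ▸ hu hm)] at this
      linarith
    · have := congrArg Real.sqrt hpE
      rw [Real.sqrt_sq (hu0 ▸ (hu hp).le)] at this
      linarith
  have hsplit (E : ℝ) (hE : 0 < E) (x : ℝ) (hx : x ∈ Ioo (-(Real.pi / 2)) (Real.pi / 2)) :
      (∫ t in tm E..u.symm (√E * Real.sin x), √(E - V t)) =
        (∫ t in u.symm (√E * Real.sin x)..tp E, √(E - V t)) ↔ x = θ √E := by
    obtain ⟨hm, hp⟩ := hcomp E hE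
    have hint {a b : ℝ} (ha : a ∈ Icc (-(Real.pi / 2)) (Real.pi / 2))
        (hb : b ∈ Icc (-(Real.pi / 2)) (Real.pi / 2)) :=
      integral_sqrt_sub_eq (hφ.of_le (by simp)) hVφ hV.continuous (Real.sqrt_nonneg E) ha hb
    rw [Real.sq_sqrt hE.le] at hint
    have hx' := Ioo_subset_Icc_self hx
    rw [hm, hp, hint (left_mem_Icc.2 hπ.le) hx', hint hx' (right_mem_Icc.2 hπ.le),
      mul_right_inj' hE.ne']
    exact (hθprop √E).2 x hx
  have hlt (E : ℝ) (hE : 0 < E) (x : ℝ) (hx : x ∈ Ioo (-(Real.pi / 2)) (Real.pi / 2)) :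
      tm E < u.symm (√E * Real.sin x) ∧ u.symm (√E * Real.sin x) < tp E := by
    obtain ⟨hm, hp⟩ := hcomp E hE
    have hr := Real.sqrt_pos.2 hE
    have hx' := Ioo_subset_Icc_self hx
    rw [hm, hp]
    exact ⟨hφmono (mul_lt_mul_of_pos_left
        (Real.strictMonoOn_sin (left_mem_Icc.2 hπ.le) hx' hx.1) hr),
      hφmono (mul_lt_mul_of_pos_left
        (Real.strictMonoOn_sin hx' (right_mem_Icc.2 hπ.le) hx.2) hr)⟩
  refine ⟨t0, ?_, fun E hE => ⟨?_, fun s hms hsp hs => ?_⟩⟩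
  · have hsqrt : ContDiffOn ℝ (⊤ : ℕ∞) Real.sqrt (Ioi 0) := fun E hE =>
      (Real.contDiffAt_sqrt (ne_of_gt hE)).contDiffWithinAt
    exact hφ.comp_contDiffOn (hsqrt.mul ((Real.contDiff_sin.comp hθ).comp_contDiffOn hsqrt))
  · have hθE := (hθprop √E).1
    exact ⟨(hlt E hE _ hθE).1, (hlt E hE _ hθE).2, (hsplit E hE _ hθE).2 rfl⟩
  · obtain ⟨hm, hp⟩ := hcomp E hE
    have hr := Real.sqrt_pos.2 hE
    rw [hm, Real.sin_neg, Real.sin_pi_div_two, mul_neg_one, ← hu.lt_iff_lt,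
      u.apply_symm_apply] at hms
    rw [hp, Real.sin_pi_div_two, mul_one, ← hu.lt_iff_lt, u.apply_symm_apply] at hsp
    have h1 : -1 < u s / √E := by rw [lt_div_iff₀ hr]; linarith
    have h2 : u s / √E < 1 := by rwa [div_lt_one hr]
    have hx : Real.arcsin (u s / √E) ∈ Ioo (-(Real.pi / 2)) (Real.pi / 2) :=
      ⟨Real.neg_pi_div_two_lt_arcsin.2 h1, Real.arcsin_lt_pi_div_two.2 h2⟩
    have hsx : s = u.symm (√E * Real.sin (Real.arcsin (u s / √E))) := by
      rw [Real.sin_arcsin h1.le h2.le, mul_div_cancel₀ _ hr.ne', u.symm_apply_apply]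
    have hxθ : Real.arcsin (u s / √E) = θ √E := by
      rw [hsx] at hs
      exact (hsplit E hE _ hx).1 hs
    rw [hsx, hxθ]
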